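/- Let R be an integral domain with fraction field k and let φ ∈ k(X) be a nonzero rational function. Then the set {𝔭 ∈ Spec(R) : φ has good reduction at 𝔭} contains a nonempty open subset of Spec(R). Concretely, there exists a nonzero r ∈ R such that every prime ideal 𝔭 of R not containing r lies in this set. -/

import Mathlib

/-- The degree of a rational function: `max (deg f) (deg g)` where `φ = f / g` in
lowest terms. -/
noncomputable def ratDegree {K : Type*} [Field K] (φ : RatFunc K) : ℕ :=
  max φ.num.natDegree φ.denom.natDegree

/-- For a domain `R` with fraction field `k`, a prime `𝔭` of `R`, and `φ ∈ k(X)`: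
`φ` has *good reduction at `𝔭`* if one can write `φ = f / g` with `f, g ∈ R[X]`,
`g mod 𝔭 ≠ 0`, and the reduction `[φ]_𝔭 = [f]_𝔭 / [g]_𝔭 ∈ [R]_𝔭(X)` (where
`[R]_𝔭 = Frac(R ⧸ 𝔭)`) has the same degree as `φ`. -/
def HasGoodReduction {R : Type*} [CommRing R] [IsDomain R]
    (φ : RatFunc (FractionRing R)) (𝔭 : Ideal R) [𝔭.IsPrime] : Prop :=
  ∃ f g : Polynomial R,
    φ = algebraMap (Polynomial (FractionRing R)) (RatFunc (FractionRing R))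
          (f.map (algebraMap R (FractionRing R))) /
        algebraMap (Polynomial (FractionRing R)) (RatFunc (FractionRing R))
          (g.map (algebraMap R (FractionRing R))) ∧
    g.map ((algebraMap (R ⧸ 𝔭) (FractionRing (R ⧸ 𝔭))).comp (Ideal.Quotient.mk 𝔭)) ≠ 0 ∧
    ratDegree
        (algebraMap (Polynomial (FractionRing (R ⧸ 𝔭))) (RatFunc (FractionRing (R ⧸ 𝔭)))
            (f.map ((algebraMap (R ⧸ 𝔭) (FractionRing (R ⧸ 𝔭))).comp (Ideal.Quotient.mk 𝔭))) /
          algebraMap (Polynomial (FractionRing (R ⧸ 𝔭))) (RatFunc (FractionRing (R ⧸ 𝔭)))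
            (g.map ((algebraMap (R ⧸ 𝔭) (FractionRing (R ⧸ 𝔭))).comp (Ideal.Quotient.mk 𝔭))))
      = ratDegree φ

open Polynomial in
theorem ratDegree_div_aux {K : Type*} [Field K] (f g : K[X]) (h : IsCoprime f g) (hg : g ≠ 0) :
    ratDegree (algebraMap K[X] (RatFunc K) f / algebraMap K[X] (RatFunc K) g)
      = max f.natDegree g.natDegree := by
  classical
  have h1 : gcd f g = 1 := by
    rw [← normalize_gcd]
    exact normalize_eq_one.2 ((gcd_isUnit_iff f g).2 h)
  unfold ratDegree
  have hl : g.leadingCoeff⁻¹ ≠ 0 := inv_ne_zero (leadingCoeff_ne_zero.2 hg)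
  rw [RatFunc.num_div, RatFunc.denom_div _ hg, h1]
  simp only [EuclideanDomain.div_one]
  rw [natDegree_C_mul hl, natDegree_C_mul hl]

open Polynomial in
theorem clear_denoms_aux {R : Type*} [CommRing R] [IsDomain R] (p : (FractionRing R)[X]) :
    ∃ (b : R) (q : R[X]), b ≠ 0 ∧
      q.map (algebraMap R (FractionRing R)) = C (algebraMap R (FractionRing R) b) * p := by
  obtain ⟨b, hb, h⟩ := IsLocalization.integerNormalization_spec (nonZeroDivisors R) p
  exact ⟨b, _, nonZeroDivisors.ne_zero hb, by
    rw [h, ← algebraMap_smul (FractionRing R) b p, smul_eq_C_mul]⟩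

/-- Let `R` be an integral domain with fraction field `k` and `φ ∈ k(X)` a nonzero
rational function.  Then there is a nonzero `r ∈ R` such that `φ` has good reduction
at every prime `𝔭` of `R` not containing `r`; in particular the locus of good
reduction contains a nonempty open subset of `Spec R`. -/
theorem good_reduction_on_basic_open
    (R : Type*) [CommRing R] [IsDomain R]
    (φ : RatFunc (FractionRing R)) (hφ : φ ≠ 0) :
    ∃ r : R, r ≠ 0 ∧ ∀ (𝔭 : Ideal R) [𝔭.IsPrime], r ∉ 𝔭 → HasGoodReduction φ 𝔭 := by
  classical
  set ι := algebraMap R (FractionRing R) with hι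
  have hinj : Function.Injective ι := IsFractionRing.injective R (FractionRing R)
  have hι0 : ∀ x : R, x ≠ 0 → ι x ≠ 0 := fun x hx h => hx (hinj (by rw [h, map_zero]))
  obtain ⟨a, F, ha, hF⟩ := clear_denoms_aux φ.num
  obtain ⟨b, G, hb, hG⟩ := clear_denoms_aux φ.denom
  obtain ⟨u, v, huv⟩ := RatFunc.isCoprime_num_denom φ
  obtain ⟨c, U, hc, hU⟩ := clear_denoms_aux u
  obtain ⟨d, V, hd, hV⟩ := clear_denoms_aux v
  rw [← hι] at hF hG hU hV
  have hnum : φ.num ≠ 0 := RatFunc.num_ne_zero hφ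
  have hden : φ.denom ≠ 0 := RatFunc.denom_ne_zero φ
  set f : Polynomial R := Polynomial.C b * F with hf
  set g : Polynomial R := Polynomial.C a * G with hg
  have hfm : f.map ι = Polynomial.C (ι (a * b)) * φ.num := by
    simp only [hf, Polynomial.map_mul, Polynomial.map_C, hF, map_mul]; ring
  have hgm : g.map ι = Polynomial.C (ι (a * b)) * φ.denom := by
    simp only [hg, Polynomial.map_mul, Polynomial.map_C, hG, map_mul]; ring
  have hab : (Polynomial.C (ι (a * b)) : Polynomial (FractionRing R)) ≠ 0 :=
    Polynomial.C_ne_zero.2 (hι0 _ (mul_ne_zero ha hb))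
  have hf0 : f ≠ 0 := by
    intro h
    rw [h, Polynomial.map_zero] at hfm
    exact mul_ne_zero hab hnum hfm.symm
  have hg0 : g ≠ 0 := by
    intro h
    rw [h, Polynomial.map_zero] at hgm
    exact mul_ne_zero hab hden hgm.symm
  have hbez : (Polynomial.C d * U) * f + (Polynomial.C c * V) * g
      = Polynomial.C (a * b * c * d) := by
    apply Polynomial.map_injective ι hinj
    simp only [Polynomial.map_add, Polynomial.map_mul, Polynomial.map_C, hfm, hgm, hU, hV, map_mul]
    linear_combination (Polynomial.C (ι a) * Polynomial.C (ι b) * Polynomial.C (ι c)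
      * Polynomial.C (ι d)) * huv
  have hφeq : φ = algebraMap _ (RatFunc (FractionRing R)) (f.map ι) /
      algebraMap _ (RatFunc (FractionRing R)) (g.map ι) := by
    rw [hfm, hgm, map_mul _ _ φ.num, map_mul _ _ φ.denom, mul_div_mul_left, RatFunc.num_div_denom]
    exact RatFunc.algebraMap_ne_zero hab
  have key : ∀ (K : Type _) [Field K] (θ : R →+* K), θ (a * b * c * d) ≠ 0 →
      θ f.leadingCoeff ≠ 0 → θ g.leadingCoeff ≠ 0 →
      g.map θ ≠ 0 ∧ ratDegree (algebraMap (Polynomial K) (RatFunc K) (f.map θ) /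
        algebraMap (Polynomial K) (RatFunc K) (g.map θ)) = max f.natDegree g.natDegree := by
    intro K _ θ hs h1 h2
    have hgθ : g.map θ ≠ 0 := by
      intro h
      apply h2
      have := congrArg (fun p => Polynomial.coeff p g.natDegree) h
      simpa [Polynomial.coeff_map] using this
    refine ⟨hgθ, ?_⟩
    rw [ratDegree_div_aux _ _ _ hgθ, Polynomial.natDegree_map_of_leadingCoeff_ne_zero θ h1,
      Polynomial.natDegree_map_of_leadingCoeff_ne_zero θ h2]
    have hm := congrArg (Polynomial.map θ) hbez
    rw [Polynomial.map_add, Polynomial.map_mul _ (p := Polynomial.C d * U),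
      Polynomial.map_mul _ (p := Polynomial.C c * V), Polynomial.map_C] at hm
    refine ⟨Polynomial.C (θ (a * b * c * d))⁻¹ * (Polynomial.C d * U).map θ,
      Polynomial.C (θ (a * b * c * d))⁻¹ * (Polynomial.C c * V).map θ, ?_⟩
    have hC : (Polynomial.C (θ (a * b * c * d))⁻¹ : Polynomial K)
        * Polynomial.C (θ (a * b * c * d)) = 1 := by
      rw [← Polynomial.C_mul, inv_mul_cancel₀ hs, Polynomial.C_1]
    linear_combination (Polynomial.C (θ (a * b * c * d))⁻¹ : Polynomial K) * hm + hC
  have hs0 : a * b * c * d ≠ 0 := mul_ne_zero (mul_ne_zero (mul_ne_zero ha hb) hc) hd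
  have hlf := Polynomial.leadingCoeff_ne_zero.2 hf0
  have hlg := Polynomial.leadingCoeff_ne_zero.2 hg0
  refine ⟨a * b * c * d * f.leadingCoeff * g.leadingCoeff,
    mul_ne_zero (mul_ne_zero hs0 hlf) hlg, ?_⟩
  intro 𝔭 _ hr
  set θ := (algebraMap (R ⧸ 𝔭) (FractionRing (R ⧸ 𝔭))).comp (Ideal.Quotient.mk 𝔭) with hθ
  have hr' : θ (a * b * c * d * f.leadingCoeff * g.leadingCoeff) ≠ 0 := by
    intro h
    apply hr
    rw [hθ, RingHom.comp_apply] at h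
    exact Ideal.Quotient.eq_zero_iff_mem.1
      (IsFractionRing.injective (R ⧸ 𝔭) (FractionRing (R ⧸ 𝔭)) (by rw [h, map_zero]))
  rw [map_mul, map_mul θ (a * b * c * d)] at hr'
  have h2 := right_ne_zero_of_mul hr'
  have h3 := left_ne_zero_of_mul hr'
  obtain ⟨k1, k2⟩ := key _ θ (left_ne_zero_of_mul h3) (right_ne_zero_of_mul h3) h2
  obtain ⟨-, k3⟩ := key _ ι (hι0 _ hs0) (hι0 _ hlf) (hι0 _ hlg)
  refine ⟨f, g, hφeq, k1, ?_⟩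
  rw [k2, ← k3, ← hφeq]
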